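/- Let p be a prime and let K be a field of characteristic p that is perfect (the map x ↦ x^p is bijective on K) and complete with respect to a multiplicative nonarchimedean norm ‖·‖. Let G be a finite group acting faithfully on K by ring automorphisms, each of which is an isometry (‖g·x‖ = ‖x‖ for all g ∈ G, x ∈ K). Let f : G → K be a map satisfying ‖f(g) − 1‖ < 1 for all g ∈ G and the cocycle condition f(gh) = f(g)·(g·f(h)) for all g, h ∈ G. Then there exists y ∈ K with ‖y − 1‖ < 1 such that f(g)·y = g·y for all g ∈ G. (That is, H¹(G, 1 + 𝔪_K) = 0, where 𝔪_K = {x ∈ K : ‖x‖ < 1}.) -/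

import Mathlib

/-- A multiplicative nonarchimedean norm on a field `K`, with respect to which `K` is
complete (every Cauchy sequence converges). -/
structure CompleteMulNorm (K : Type*) [Field K] where
  nrm : K → ℝ
  nonneg : ∀ x, 0 ≤ nrm x
  eq_zero_iff : ∀ x, nrm x = 0 ↔ x = 0
  mul : ∀ x y, nrm (x * y) = nrm x * nrm y
  nonarch : ∀ x y, nrm (x + y) ≤ max (nrm x) (nrm y)
  complete : ∀ u : ℕ → K,
    (∀ ε : ℝ, 0 < ε → ∃ N : ℕ, ∀ m ≥ N, ∀ n ≥ N, nrm (u m - u n) < ε) →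
    ∃ x : K, ∀ ε : ℝ, 0 < ε → ∃ N : ℕ, ∀ n ≥ N, nrm (u n - x) < ε

open Filter

namespace CompleteMulNorm

variable {K : Type*} [Field K] (ν : CompleteMulNorm K)

theorem nrm_zero : ν.nrm 0 = 0 := (ν.eq_zero_iff 0).2 rfl

theorem nrm_one : ν.nrm 1 = 1 := by
  have h : ν.nrm 1 ≠ 0 := fun h => one_ne_zero ((ν.eq_zero_iff 1).1 h)
  have h2 := ν.mul 1 1
  rw [mul_one] at h2
  exact (mul_eq_left₀ h).1 h2.symm

theorem nrm_pow (x : K) (n : ℕ) : ν.nrm (x ^ n) = ν.nrm x ^ n := by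
  induction n with
  | zero => simp [ν.nrm_one]
  | succ n ih => rw [pow_succ, pow_succ, ν.mul, ih]

theorem nrm_neg (x : K) : ν.nrm (-x) = ν.nrm x := by
  have h := congrArg ν.nrm (neg_sq x)
  rw [ν.nrm_pow, ν.nrm_pow] at h
  exact (pow_left_inj₀ (ν.nonneg _) (ν.nonneg _) two_ne_zero).1 h

theorem nrm_sum_lt_one {ι : Type*} (s : Finset ι) (u : ι → K) (hu : ∀ i ∈ s, ν.nrm (u i) < 1) :
    ν.nrm (∑ i ∈ s, u i) < 1 :=
  Finset.sum_induction u (fun x => ν.nrm x < 1)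
    (fun x y hx hy => (ν.nonarch x y).trans_lt (max_lt hx hy))
    (by simp [ν.nrm_zero]) hu

theorem nrm_eq_one_of_nrm_sub_one_lt {x : K} (hx : ν.nrm (x - 1) < 1) : ν.nrm x = 1 := by
  apply le_antisymm
  · have h := ν.nonarch (x - 1) 1
    rw [sub_add_cancel, ν.nrm_one] at h
    exact h.trans (max_le hx.le le_rfl)
  · by_contra! hlt
    have h := ν.nonarch x (-(x - 1))
    rw [ν.nrm_neg, show x + -(x - 1) = 1 by ring, ν.nrm_one] at h
    exact absurd (h.trans_lt (max_lt hlt hx)) (lt_irrefl _)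

theorem nrm_inv_sub_one_lt {x : K} (hx : ν.nrm (x - 1) < 1) : ν.nrm (x⁻¹ - 1) < 1 := by
  have h1 := ν.nrm_eq_one_of_nrm_sub_one_lt hx
  have h0 : x ≠ 0 := by
    rintro rfl
    simp [ν.nrm_zero] at h1
  have h := ν.mul x (x⁻¹ - 1)
  rw [h1, one_mul, show x * (x⁻¹ - 1) = -(x - 1) by field_simp; ring, ν.nrm_neg] at h
  rwa [← h]

end CompleteMulNorm

/-- A finite group acting faithfully on a field admits an element of trace `1`. -/
theorem exists_sum_smul_eq_one (K G : Type*) [Field K] [Group G] [Fintype G]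
    [MulSemiringAction G K] [FaithfulSMul G K] : ∃ a : K, ∑ g : G, g • a = 1 := by
  obtain ⟨z, hz⟩ : ∃ z : K, ∑ g : G, g • z ≠ 0 := by
    by_contra! h
    have hli := (linearIndependent_monoidHom K K).comp
      (fun g : G => (MulSemiringAction.toRingHom G K g : K →* K)) (by
        intro g h hgh
        exact FaithfulSMul.eq_of_smul_eq_smul fun x : K => DFunLike.congr_fun hgh x)
    have := Fintype.linearIndependent_iff.1 hli (fun _ => 1) (by
      ext x
      simpa using h x) 1
    exact one_ne_zero this
  have hfix (h : G) : h • (∑ g : G, g • z) = ∑ g : G, g • z := by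
    rw [Finset.smul_sum]
    simp_rw [smul_smul]
    exact Equiv.sum_comp (Equiv.mulLeft h) fun g => g • z
  refine ⟨z * (∑ g : G, g • z)⁻¹, ?_⟩
  simp_rw [smul_mul', smul_inv'', hfix, ← Finset.sum_mul]
  exact mul_inv_cancel₀ hz

/-- For a complete perfect multiplicatively normed field `K` of
characteristic `p` with a faithful isometric action of a finite group `G`, every
`1`-cocycle of `G` with values in `1 + 𝔪_K` is a coboundary: `H¹(G, 1 + 𝔪_K) = 0`. -/
theorem h1_one_add_maximal_ideal_trivial
    (p : ℕ) (hp : p.Prime) (K : Type*) [Field K] [CharP K p]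
    (hperf : Function.Bijective fun x : K => x ^ p)
    (ν : CompleteMulNorm K)
    (G : Type*) [Group G] [Finite G] [MulSemiringAction G K] [FaithfulSMul G K]
    (hisom : ∀ (g : G) (x : K), ν.nrm (g • x) = ν.nrm x)
    (f : G → K)
    (hf1 : ∀ g : G, ν.nrm (f g - 1) < 1)
    (hcoc : ∀ g h : G, f (g * h) = f g * (g • f h)) :
    ∃ y : K, ν.nrm (y - 1) < 1 ∧ ∀ g : G, f g * y = g • y := by
  have := Fintype.ofFinite G
  have : Fact p.Prime := ⟨hp⟩
  obtain ⟨a, ha⟩ := exists_sum_smul_eq_one K G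
  obtain ⟨n, hn⟩ : ∃ n : ℕ, ∀ g, ν.nrm (f g - 1) ^ p ^ n * ν.nrm a < 1 := by
    refine (eventually_all.2 fun g => ?_ : ∀ᶠ n : ℕ in atTop, ∀ g, _).exists
    have h := (((tendsto_pow_atTop_nhds_zero_of_lt_one (ν.nonneg _) (hf1 g)).comp
      (tendsto_pow_atTop_atTop_of_one_lt hp.one_lt)).mul_const (ν.nrm a))
    rw [zero_mul] at h
    exact h.eventually_lt_const one_pos
  obtain ⟨b, rfl⟩ : ∃ b : K, b ^ p ^ n = a := by
    obtain ⟨b, hb⟩ := hperf.surjective.iterate n a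
    exact ⟨b, by rw [← hb, pow_iterate]⟩
  have hb : ∑ g : G, g • b = 1 := by
    apply iterateFrobenius_inj K p n
    rw [map_sum, map_one, ← ha]
    simp [iterateFrobenius_def, smul_pow']
  set w := ∑ h : G, f h * h • b with hw
  have hw1 : ν.nrm (w - 1) < 1 := by
    rw [← hb, hw, ← Finset.sum_sub_distrib]
    refine ν.nrm_sum_lt_one _ _ fun g _ => ?_
    rw [← sub_one_mul, ν.mul, hisom]
    have h := hn g
    rw [ν.nrm_pow, ← mul_pow] at h
    exact (pow_lt_one_iff_of_nonneg (mul_nonneg (ν.nonneg _) (ν.nonneg _))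
      (pow_ne_zero n hp.ne_zero)).1 h
  have hgw (g : G) : f g * g • w = w := by
    rw [hw, Finset.smul_sum, Finset.mul_sum, ← Equiv.sum_comp (Equiv.mulLeft g) fun h => f h * h • b]
    refine Finset.sum_congr rfl fun h _ => ?_
    rw [Equiv.coe_mulLeft, hcoc, smul_mul', smul_smul, mul_assoc]
  have hw0 : w ≠ 0 := by
    intro h0
    have h := ν.nrm_eq_one_of_nrm_sub_one_lt hw1
    simp [h0, ν.nrm_zero] at h
  refine ⟨w⁻¹, ν.nrm_inv_sub_one_lt hw1, fun g => ?_⟩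
  rw [smul_inv'']
  have hg0 : g • w ≠ 0 := (smul_ne_zero_iff_ne g).2 hw0
  rw [mul_inv_eq_iff_eq_mul₀ hw0, eq_inv_mul_iff_mul_eq₀ hg0, mul_comm, hgw]
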